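/- Let G be a finite group, let L be its lattice of normal subgroups, and let {e} = S_0 < S_1 < ⋯ < S_n = G be the increasing enumeration of all elements of L that cut L. Suppose that for each i ∈ {0,…,n−1}, the interval I[S_i, S_{i+1}] of L either contains exactly the two elements S_i and S_{i+1}, or does not split. Then the clone Comp(G) of congruence preserving functions of G is finitely generated. -/

import Mathlib

/-- A finitary operation on `A`. -/
abbrev FinOp (A : Type*) := Σ n : ℕ, (Fin n → A) → A

/-- Membership in the clone generated by a set `F` of finitary operations:
the smallest set of finitary operations containing `F` and all projections
and closed under composition. -/
inductive InClone {A : Type*} (F : Set (FinOp A)) : {n : ℕ} → ((Fin n → A) → A) → Prop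
  | proj {n : ℕ} (i : Fin n) : InClone F fun x => x i
  | base {n : ℕ} (f : (Fin n → A) → A) : (⟨n, f⟩ : FinOp A) ∈ F → InClone F f
  | comp {n m : ℕ} (f : (Fin m → A) → A) (g : Fin m → (Fin n → A) → A) :
      InClone F f → (∀ i, InClone F (g i)) → InClone F fun x => f fun i => g i x

/-- A function `G^k → G` is compatible (congruence preserving): it preserves
every congruence, i.e. for every normal subgroup `N` and tuples `a ≡ b mod N`
one has `f a ≡ f b mod N`. -/
def Compatible {G : Type*} [Group G] {k : ℕ} (f : (Fin k → G) → G) : Prop :=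
  ∀ N : Subgroup G, N.Normal → ∀ a b : Fin k → G,
    (∀ i, (a i)⁻¹ * b i ∈ N) → (f a)⁻¹ * f b ∈ N

/-- The clone `Comp G` of congruence preserving functions of `G` is finitely
generated: some finite set of compatible functions generates, as a clone,
exactly the compatible functions (of all arities `≥ 1`). -/
def CompFG (G : Type*) [Group G] : Prop :=
  ∃ F : Set (FinOp G), F.Finite ∧ (∀ f ∈ F, 1 ≤ f.1 ∧ Compatible f.2) ∧
    ∀ (n : ℕ), 1 ≤ n → ∀ f : (Fin n → G) → G, (Compatible f ↔ InClone F f)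

/-- The lattice of normal subgroups of `G`. -/
instance NormalSubgroup.instLattice {G : Type*} [Group G] :
    Lattice {N : Subgroup G // N.Normal} :=
  Subtype.lattice (fun _ _ hA hB => @Subgroup.sup_normal _ _ _ _ hA hB)
    (fun _ _ hA hB => @Subgroup.normal_inf_normal _ _ _ _ hA hB)

instance NormalSubgroup.instBoundedOrder {G : Type*} [Group G] :
    BoundedOrder {N : Subgroup G // N.Normal} where
  top := ⟨⊤, inferInstance⟩
  le_top A := (le_top : A.1 ≤ ⊤)
  bot := ⟨⊥, inferInstance⟩
  bot_le A := (bot_le : ⊥ ≤ A.1)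

/-- `β` cuts the lattice: every element is comparable with `β`. -/
def Cuts {L : Type*} [Lattice L] (β : L) : Prop := ∀ α : L, α ≤ β ∨ β ≤ α

/-- The interval `I[a,b]` splits: it has a splitting pair `(δ, ε)`. -/
def IntervalSplits {L : Type*} [Lattice L] (a b : L) : Prop :=
  ∃ δ ε : L, a ≤ δ ∧ δ < b ∧ a < ε ∧ ε ≤ b ∧
    ∀ K : L, a ≤ K → K ≤ b → K ≤ δ ∨ ε ≤ K

section CongruencePreserving

variable {G : Type*} [Group G]

/-- `Compatible` for operations with an arbitrary index type of arguments. -/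
def Preserves {ι : Type*} (f : (ι → G) → G) : Prop :=
  ∀ N : Subgroup G, N.Normal → ∀ a b : ι → G,
    (∀ i, (a i)⁻¹ * b i ∈ N) → (f a)⁻¹ * f b ∈ N

namespace Preserves

variable {ι κ : Type*}

theorem proj (i : ι) : Preserves fun x : ι → G => x i := fun _ _ _ _ h => h i

theorem const (c : G) : Preserves fun _ : ι → G => c := fun N _ _ _ _ => by simp [N.one_mem]

theorem comp {f : (κ → G) → G} {g : κ → (ι → G) → G} (hf : Preserves f)
    (hg : ∀ j, Preserves (g j)) : Preserves fun x => f fun j => g j x :=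
  fun N hN a b h => hf N hN _ _ fun j => hg j N hN a b h

theorem mul {f g : (ι → G) → G} (hf : Preserves f) (hg : Preserves g) :
    Preserves fun x => f x * g x := by
  intro N hN a b h
  have h1 := QuotientGroup.eq.2 (hf N hN a b h)
  have h2 := QuotientGroup.eq.2 (hg N hN a b h)
  rw [← QuotientGroup.eq, QuotientGroup.mk_mul, QuotientGroup.mk_mul, h1, h2]

theorem inv {f : (ι → G) → G} (hf : Preserves f) : Preserves fun x => (f x)⁻¹ := by
  intro N hN a b h
  have h1 := QuotientGroup.eq.2 (hf N hN a b h)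
  rw [← QuotientGroup.eq, QuotientGroup.mk_inv, QuotientGroup.mk_inv, h1]

theorem update [DecidableEq ι] {f : (ι → G) → G} (hf : Preserves f) (i : ι)
    {g : (ι → G) → G} (hg : Preserves g) :
    Preserves fun x => f (Function.update x i (g x)) := by
  have : ∀ j, Preserves fun x : ι → G => Function.update x i (g x) j := by
    intro j
    by_cases hj : j = i
    · subst hj; simpa using hg
    · simpa [hj] using proj (G := G) j
  exact hf.comp this

theorem apply_mem_of_apply_mem {f : (ι → G) → G} (hf : Preserves f) {N : Subgroup G}
    (hN : N.Normal) {a b : ι → G} (h : ∀ i, (a i)⁻¹ * b i ∈ N) (ha : f a ∈ N) : f b ∈ N := by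
  simpa using N.mul_mem ha (hf N hN a b h)

end Preserves

section Guard

open Classical in
/-- The second argument, if it lies in `M` and the first one lies in `c H`; otherwise `1`. -/
noncomputable def guardOp (H M : Subgroup G) (c x y : G) : G :=
  if c⁻¹ * x ∈ H ∧ y ∈ M then y else 1

variable {H M : Subgroup G}

theorem guardOp_mem (c x y : G) : guardOp H M c x y ∈ M := by
  unfold guardOp
  split_ifs with h
  exacts [h.2, M.one_mem]

theorem guardOp_of_mem {c x y : G} (hx : c⁻¹ * x ∈ H) (hy : y ∈ M) : guardOp H M c x y = y :=
  if_pos ⟨hx, hy⟩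

theorem guardOp_of_notMem {c x : G} (y : G) (hx : c⁻¹ * x ∉ H) : guardOp H M c x y = 1 :=
  if_neg fun h => hx h.1

theorem compatible_guardOp (hHM : H ≤ M)
    (gap : ∀ K : Subgroup G, K.Normal → K ≤ H ∨ M ≤ K) (c : G) :
    Compatible fun x : Fin 2 → G => guardOp H M c (x 0) (x 1) := by
  intro K hK a b h
  rcases gap K hK with hle | hle
  · have h0 : c⁻¹ * b 0 = (c⁻¹ * a 0) * ((a 0)⁻¹ * b 0) := by group
    have h1 : b 1 = a 1 * ((a 1)⁻¹ * b 1) := by group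
    have e0 : c⁻¹ * b 0 ∈ H ↔ c⁻¹ * a 0 ∈ H := by
      rw [h0]; exact H.mul_mem_cancel_right (hle (h 0))
    have e1 : b 1 ∈ M ↔ a 1 ∈ M := by
      rw [h1]; exact M.mul_mem_cancel_right (hHM (hle (h 1)))
    by_cases hab : c⁻¹ * a 0 ∈ H ∧ a 1 ∈ M
    · have hab' : c⁻¹ * b 0 ∈ H ∧ b 1 ∈ M := ⟨e0.2 hab.1, e1.2 hab.2⟩
      simpa only [guardOp, if_pos hab, if_pos hab'] using h 1
    · have hab' : ¬ (c⁻¹ * b 0 ∈ H ∧ b 1 ∈ M) := fun h => hab ⟨e0.1 h.1, e1.1 h.2⟩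
      simp only [guardOp, if_neg hab, if_neg hab', inv_one, mul_one, K.one_mem]
  · exact hle (M.mul_mem (M.inv_mem (guardOp_mem ..)) (guardOp_mem ..))

open Classical in
/-- A class of operations closed under guarding by single cosets is closed under restriction
to boxes of cosets. -/
theorem box_restriction_closed {k : ℕ} {Q : ((Fin k → G) → G) → Prop} (c : Fin k → G)
    (hQ : ∀ i u, Q u → Q fun x => guardOp H M (c i) (x i) (u x))
    {u : (Fin k → G) → G} (hu : Q u) (huM : ∀ x, u x ∈ M) :
    Q fun x => if ∀ i, (c i)⁻¹ * x i ∈ H then u x else 1 := by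
  suffices ∀ T : Finset (Fin k), Q fun x => if ∀ i ∈ T, (c i)⁻¹ * x i ∈ H then u x else 1 by
    simpa using this Finset.univ
  intro T
  induction T using Finset.induction_on with
  | empty => simpa using hu
  | insert i T _ ih =>
    convert hQ i _ ih using 2 with x
    by_cases hi : (c i)⁻¹ * x i ∈ H
    · rw [guardOp_of_mem hi (by split_ifs; exacts [huM x, M.one_mem])]
      simp [hi]
    · rw [guardOp_of_notMem _ hi]
      simp [hi]

end Guard

section BoundedArity

variable (G) in
/-- The compatible operations of arity between `1` and `m`. -/
def compatOps (m : ℕ) : Set (FinOp G) := {f | 1 ≤ f.1 ∧ f.1 ≤ m ∧ Compatible f.2}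

theorem finite_compatOps [Finite G] (m : ℕ) : (compatOps G m).Finite := by
  refine ((Set.finite_Iic m).biUnion fun n _ =>
    Set.finite_range fun f : (Fin n → G) → G => (⟨n, f⟩ : FinOp G)).subset ?_
  rintro ⟨n, f⟩ ⟨-, hn, -⟩
  exact Set.mem_biUnion (show n ∈ Set.Iic m from hn) ⟨f, rfl⟩

theorem InClone.mono {A : Type*} {F F' : Set (FinOp A)} (hF : F ⊆ F') {n : ℕ}
    {f : (Fin n → A) → A} (hf : InClone F f) : InClone F' f := by
  induction hf with
  | proj i => exact .proj i
  | base f h => exact .base f (hF h)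
  | comp f g _ _ ihf ihg => exact .comp f g ihf ihg

theorem InClone.compatible {F : Set (FinOp G)} (hF : ∀ f ∈ F, Compatible f.2) {n : ℕ}
    {f : (Fin n → G) → G} (hf : InClone F f) : Compatible f := by
  induction hf with
  | proj i => exact Preserves.proj i
  | base f h => exact hF _ h
  | comp f g _ _ ihf ihg => exact Preserves.comp ihf ihg

theorem compatOps_mono {m m' : ℕ} (h : m ≤ m') : compatOps G m ⊆ compatOps G m' :=
  fun _ hf => ⟨hf.1, hf.2.1.trans h, hf.2.2⟩

variable {m k : ℕ}

theorem InClone.binary (hm : 2 ≤ m) {b : G → G → G}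
    (hb : Compatible fun x : Fin 2 → G => b (x 0) (x 1)) {f g : (Fin k → G) → G}
    (hf : InClone (compatOps G m) f) (hg : InClone (compatOps G m) g) :
    InClone (compatOps G m) fun x => b (f x) (g x) := by
  have h := InClone.comp (F := compatOps G m) (n := k) (fun x : Fin 2 → G => b (x 0) (x 1))
    ![f, g] (.base _ ⟨by norm_num, hm, hb⟩) (by
      intro i
      fin_cases i
      exacts [hf, hg])
  simpa using h

theorem InClone.mul (hm : 2 ≤ m) {f g : (Fin k → G) → G}
    (hf : InClone (compatOps G m) f) (hg : InClone (compatOps G m) g) :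
    InClone (compatOps G m) fun x => f x * g x :=
  .binary hm (Preserves.mul (Preserves.proj 0) (Preserves.proj 1)) hf hg

theorem InClone.const (hm : 1 ≤ m) (hk : 1 ≤ k) (c : G) :
    InClone (compatOps G m) fun _ : Fin k → G => c :=
  .comp (m := 1) (fun _ => c) (fun _ x => x ⟨0, hk⟩)
    (.base _ ⟨le_rfl, hm, Preserves.const c⟩) fun _ => .proj _

end BoundedArity

section Absorbing

variable (N : Subgroup G)

/-- `u` takes values in `N` as soon as one of the arguments with index in `I` is `1`. -/
def AbsorbsOn (I : Finset ℕ) (u : (ℕ → G) → G) : Prop :=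
  ∀ z, ∀ j ∈ I, z j = 1 → u z ∈ N

/-- On the box `∏ α i`, operations absorbing modulo `N` in sufficiently many arguments take
values in `K`: the higher commutators of the `α i` are eventually below `K`. -/
def AbsorbingInto (α : ℕ → Subgroup G) (K : Subgroup G) : Prop :=
  ∃ I : Finset ℕ, ∀ u, Preserves u → AbsorbsOn N I u → ∀ y, (∀ i, y i ∈ α i) → u y ∈ K

variable {N} {α β : ℕ → Subgroup G} {K K' : Subgroup G}

theorem AbsorbsOn.mono {I I' : Finset ℕ} (h : I ⊆ I') {u : (ℕ → G) → G}
    (hu : AbsorbsOn N I' u) : AbsorbsOn N I u := fun z j hj => hu z j (h hj)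

theorem AbsorbingInto.inf (h : AbsorbingInto N α K) (h' : AbsorbingInto N α K') :
    AbsorbingInto N α (K ⊓ K') := by
  obtain ⟨I, hI⟩ := h
  obtain ⟨I', hI'⟩ := h'
  exact ⟨I ∪ I', fun u hu hua y hy =>
    ⟨hI u hu (hua.mono Finset.subset_union_left) y hy,
      hI' u hu (hua.mono Finset.subset_union_right) y hy⟩⟩

theorem AbsorbingInto.anti (h : AbsorbingInto N α K) (hβ : β ≤ α) : AbsorbingInto N β K := by
  obtain ⟨I, hI⟩ := h
  exact ⟨I, fun u hu hua y hy => hI u hu hua y fun i => hβ i (hy i)⟩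

theorem absorbingInto_apply (i : ℕ) (hα : (α i).Normal) (hN : N ≤ α i) :
    AbsorbingInto N α (α i) := by
  refine ⟨{i}, fun u hu hua y hy => ?_⟩
  refine hu.apply_mem_of_apply_mem hα (a := Function.update y i 1) (fun j => ?_)
    (hN (hua _ i (by simp) (by simp)))
  by_cases hj : j = i
  · subst hj; simpa using hy j
  · simp [hj, (α i).one_mem]

theorem absorbingInto_self (hN : N.Normal) : AbsorbingInto N (fun _ => N) N :=
  absorbingInto_apply (α := fun _ => N) 0 hN le_rfl

theorem AbsorbingInto.update_sup {r : ℕ} {A B : Subgroup G} (hB : B.Normal)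
    (hA' : AbsorbingInto N (Function.update α r A) N)
    (hB' : AbsorbingInto N (Function.update α r B) N) :
    AbsorbingInto N (Function.update α r (A ⊔ B)) N := by
  obtain ⟨I, hI⟩ := hA'
  obtain ⟨I', hI'⟩ := hB'
  refine ⟨I ∪ I', fun u hu hua y hy => ?_⟩
  have hyr : y r ∈ A ⊔ B := by simpa using hy r
  obtain ⟨a, ha, b, hb, hab⟩ := Subgroup.mem_sup_of_normal_right.1 hyr
  have box : ∀ {C : Subgroup G} {g : G}, g ∈ C →
      ∀ i, Function.update y r g i ∈ Function.update α r C i := by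
    intro C g hg i
    by_cases hi : i = r
    · subst hi; simpa using hg
    · simpa [hi] using hy i
  have h1 : u (Function.update y r a) ∈ N :=
    hI u hu (hua.mono Finset.subset_union_left) _ (box ha)
  have h2 := hI' (fun z => u (Function.update z r (a * z r)) * (u (Function.update z r a))⁻¹)
    ((hu.update r ((Preserves.const a).mul (Preserves.proj r))).mul
      (hu.update r (Preserves.const a)).inv) (by
    intro z j hj hz
    by_cases hjr : j = r
    · subst hjr
      simp [hz, N.one_mem]
    · have hj' : j ∈ I ∪ I' := Finset.mem_union_right _ hj
      exact N.mul_mem (hua _ j hj' (by simpa [hjr] using hz))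
        (N.inv_mem (hua _ j hj' (by simpa [hjr] using hz)))) _ (box hb)
  simp only [Function.update_idem, Function.update_self, hab, Function.update_eq_self] at h2
  simpa using N.mul_mem h2 h1

/-- If the interval `I[N, M]` does not split, then the operations that are absorbing modulo `N`
in sufficiently many arguments are trivial modulo `N` on `M`. -/
theorem absorbingInto_of_not_intervalSplits [Finite G] {N M : {H : Subgroup G // H.Normal}}
    (hNM : N ≤ M) (hsplit : ¬ IntervalSplits N M) :
    AbsorbingInto N.1 (fun _ => M.1) N.1 := by
  by_contra hcon
  let 𝒦 : Set {H : Subgroup G // H.Normal} :=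
    {K | N ≤ K ∧ K ≤ M ∧ ∃ α : ℕ → Subgroup G, {i | α i ≠ M.1}.Finite ∧ α ≤ (fun _ => M.1) ∧
      AbsorbingInto N.1 α K.1 ∧ ¬ AbsorbingInto N.1 α N.1}
  have hM : M ∈ 𝒦 := ⟨hNM, le_rfl, fun _ => M.1, by simp, le_rfl,
    absorbingInto_apply (α := fun _ => M.1) 0 M.2 hNM, hcon⟩
  obtain ⟨ε, ⟨hNε, hεM, α, hfin, hαM, hαε, hαN⟩, hmin⟩ :=
    (Set.toFinite 𝒦).exists_minimal ⟨M, hM⟩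
  obtain ⟨r, hr⟩ := hfin.exists_notMem
  have hr : α r = M.1 := by simpa using hr
  let 𝒟 : Set {H : Subgroup G // H.Normal} :=
    {β | N ≤ β ∧ β ≤ M ∧ AbsorbingInto N.1 (Function.update α r β.1) N.1}
  have hN𝒟 : N ∈ 𝒟 := by
    refine ⟨le_rfl, hNM, ?_⟩
    have := absorbingInto_apply (N := N.1) (α := Function.update α r N.1) r
      (by simpa using N.2) (by simp)
    simpa using this
  obtain ⟨δ, ⟨hNδ, hδM, hδ⟩, hmax⟩ := (Set.toFinite 𝒟).exists_maximal ⟨N, hN𝒟⟩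
  refine hsplit ⟨δ, ε, hNδ, lt_of_le_of_ne hδM ?_, lt_of_le_of_ne hNε ?_, hεM, ?_⟩
  · rintro rfl
    rw [← hr, Function.update_eq_self] at hδ
    exact hαN hδ
  · rintro rfl
    exact hαN hαε
  · intro β hNβ hβM
    by_cases hβ : AbsorbingInto N.1 (Function.update α r β.1) N.1
    · left
      exact le_sup_right.trans
        (hmax (y := δ ⊔ β) ⟨hNδ.trans le_sup_left, sup_le hδM hβM, hδ.update_sup β.2 hβ⟩
          le_sup_left)
    · right
      have hle : Function.update α r β.1 ≤ α := by
        rw [update_le_self_iff, hr]; exact hβM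
      refine (hmin (y := β ⊓ ε) ⟨le_inf hNβ hNε, inf_le_right.trans hεM,
        Function.update α r β.1, ?_, hle.trans hαM, ?_, hβ⟩ inf_le_right).trans inf_le_left
      · refine (hfin.insert r).subset fun i hi => ?_
        by_cases hir : i = r
        · exact Or.inl hir
        · right; simpa [hir] using hi
      · refine AbsorbingInto.inf ?_ (hαε.anti hle)
        have := absorbingInto_apply (N := N.1) (α := Function.update α r β.1) r
          (by simpa using β.2) (by simpa using hNβ)
        simpa using this

/-- Transfer of triviality to operations of finite arity, absorbing at an arbitrary point. -/
theorem apply_mem_of_absorbing {H : Subgroup G} {I₀ : Finset ℕ}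
    (hI₀ : ∀ u, Preserves u → AbsorbsOn N I₀ u → ∀ y, (∀ i, y i ∈ H) → u y ∈ N)
    {k : ℕ} {h : (Fin k → G) → G} (hh : Compatible h) {c : Fin k → G} {I : Finset (Fin k)}
    (habs : ∀ x, ∀ i ∈ I, h (Function.update x i (c i)) ∈ N) (hcard : I₀.card ≤ I.card)
    {x : Fin k → G} (hx : ∀ i, (c i)⁻¹ * x i ∈ H) : h x ∈ N := by
  classical
  obtain ⟨e⟩ : Nonempty (I₀ ↪ I) := Function.Embedding.nonempty_of_card_le (by simpa using hcard)
  let arg : Fin k → (ℕ → G) → G := fun i z =>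
    if hi : ∃ j : I₀, (e j : Fin k) = i then c i * z hi.choose else x i
  have harg : ∀ i, Preserves (arg i) := by
    intro i
    by_cases hi : ∃ j : I₀, (e j : Fin k) = i
    · simpa only [arg, dif_pos hi] using (Preserves.const (c i)).mul (Preserves.proj _)
    · simpa only [arg, dif_neg hi] using Preserves.const (x i)
  have arg_apply : ∀ (j : I₀) z, arg (e j) z = c (e j) * z j := by
    intro j z
    have hj : ∃ j' : I₀, (e j' : Fin k) = e j := ⟨j, rfl⟩
    have : hj.choose = j := e.injective (Subtype.ext hj.choose_spec)
    simp only [arg, dif_pos hj]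
    rw [this]
  let y : ℕ → G := fun n =>
    if hn : n ∈ I₀ then (c (e ⟨n, hn⟩))⁻¹ * x (e ⟨n, hn⟩) else 1
  have hy : ∀ n, y n ∈ H := by
    intro n
    dsimp only [y]
    split_ifs
    exacts [hx _, H.one_mem]
  have key := hI₀ (fun z => h fun i => arg i z) (Preserves.comp hh harg) (by
    intro z j hj hz
    have := habs (fun i => arg i z) (e ⟨j, hj⟩) (e ⟨j, hj⟩).2
    rwa [Function.update_eq_self_iff.2] at this
    rw [arg_apply, hz, mul_one])
    y hy
  convert key using 2
  funext i
  by_cases hi : ∃ j : I₀, (e j : Fin k) = i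
  · obtain ⟨j, rfl⟩ := hi
    rw [arg_apply j y]
    simp [y]
  · simp only [arg, dif_neg hi]

end Absorbing

section Generation

variable {N H M : Subgroup G} {m k : ℕ}

open Classical in
/-- Operations living on a box of cosets of `H` are generated modulo `N`. Here `h` depends on
the arguments in `J` and is absorbing modulo `N` in the arguments in `I`. -/
theorem exists_inClone_of_box (hN : N.Normal) (hHM : H ≤ M)
    (gap : ∀ K : Subgroup G, K.Normal → K ≤ H ∨ M ≤ K) {I₀ : Finset ℕ}
    (hI₀ : ∀ u, Preserves u → AbsorbsOn N I₀ u → ∀ y, (∀ i, y i ∈ H) → u y ∈ N)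
    (hm : 2 ≤ m) (hIm : I₀.card ≤ m) (hk : 1 ≤ k) (c : Fin k → G) (d : ℕ) :
    ∀ I J : Finset (Fin k), I ⊆ J → (J \ I).card = d → ∀ h : (Fin k → G) → G, Compatible h →
      (∀ x, h x ∈ M) → (∀ x, (¬ ∀ i, (c i)⁻¹ * x i ∈ H) → h x = 1) →
      (∀ x y, (∀ i, (c i)⁻¹ * x i ∈ H) → (∀ i, (c i)⁻¹ * y i ∈ H) →
        (∀ i ∈ J, x i = y i) → h x = h y) →
      (∀ x, ∀ i ∈ I, h (Function.update x i (c i)) ∈ N) →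
      ∃ g, InClone (compatOps G m) g ∧ ∀ x, (g x)⁻¹ * h x ∈ N := by
  have hguard := compatible_guardOp hHM gap
  induction d with
  | zero =>
    intro I J hIJ hd h hh hhM hout hdep habs
    obtain rfl : I = J := hIJ.antisymm (by simpa using hd)
    by_cases hcard : I₀.card ≤ I.card
    · refine ⟨fun _ => 1, .const (by omega) hk 1, fun x => ?_⟩
      by_cases hx : ∀ i, (c i)⁻¹ * x i ∈ H
      · simpa using apply_mem_of_absorbing hI₀ hh habs hcard hx
      · simp [hout x hx, N.one_mem]
    · obtain ⟨φ⟩ : Nonempty (I ↪ Fin m) :=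
        Function.Embedding.nonempty_of_card_le (by simp; omega)
      let ψ : Fin m → Fin k := Function.extend φ Subtype.val fun _ => ⟨0, hk⟩
      let h' : (Fin m → G) → G := fun y =>
        h fun i => if hi : i ∈ I then y (φ ⟨i, hi⟩) else c i
      have hh' : Compatible h' := by
        refine Preserves.comp (g := fun i y => if hi : i ∈ I then y (φ ⟨i, hi⟩) else c i) hh
          fun i => ?_
        by_cases hi : i ∈ I
        · simpa only [dif_pos hi] using Preserves.proj _
        · simpa only [dif_neg hi] using Preserves.const _
      have hcl : InClone (compatOps G m) fun x => h' fun j => x (ψ j) :=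
        .comp h' (fun j x => x (ψ j)) (.base _ ⟨by show 1 ≤ m; omega, le_rfl, hh'⟩)
          fun j => .proj _
      refine ⟨_, box_restriction_closed (H := H) (M := M) c
        (fun i u hu => .binary hm (hguard (c i)) (.proj i) hu) hcl (fun x => hhM _),
        fun x => ?_⟩
      by_cases hx : ∀ i, (c i)⁻¹ * x i ∈ H
      · simp only [hx, implies_true, if_true]
        suffices h' (fun j => x (ψ j)) = h x by simp [this, N.one_mem]
        refine hdep _ _ (fun i => ?_) hx fun i hi => ?_
        · split_ifs with hi
          · simpa [ψ, φ.injective.extend_apply] using hx i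
          · simp [H.one_mem]
        · simp [hi, ψ, φ.injective.extend_apply]
      · simp [hx, hout x hx, N.one_mem]
  | succ d ih =>
    intro I J hIJ hd h hh hhM hout hdep habs
    obtain ⟨j, hj⟩ : (J \ I).Nonempty := Finset.card_pos.1 (by omega)
    obtain ⟨hjJ, hjI⟩ := Finset.mem_sdiff.1 hj
    let h₁ : (Fin k → G) → G := fun x =>
      if ∀ i, (c i)⁻¹ * x i ∈ H then h (Function.update x j (c j)) else 1
    have h₁in : ∀ x, (∀ i, (c i)⁻¹ * x i ∈ H) → h₁ x = h (Function.update x j (c j)) :=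
      fun x hx => if_pos hx
    have h₁out : ∀ x, (¬ ∀ i, (c i)⁻¹ * x i ∈ H) → h₁ x = 1 := fun x hx => if_neg hx
    have hh₁ : Compatible h₁ := by
      refine box_restriction_closed (Q := Compatible) (H := H) (M := M) c (fun i u hu => ?_)
        (Preserves.update hh j (Preserves.const (c j))) (fun x => hhM _)
      refine Preserves.comp (g := ![fun x => x i, u]) (hguard (c i)) fun l => ?_
      fin_cases l
      exacts [Preserves.proj i, hu]
    have hh₁M : ∀ x, h₁ x ∈ M := by
      intro x
      by_cases hx : ∀ i, (c i)⁻¹ * x i ∈ H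
      · rw [h₁in x hx]; exact hhM _
      · rw [h₁out x hx]; exact M.one_mem
    have box_update : ∀ x l, (∀ i, (c i)⁻¹ * x i ∈ H) →
        ∀ i, (c i)⁻¹ * Function.update x l (c l) i ∈ H := by
      intro x l hx i
      by_cases hi : i = l
      · subst hi; simp [H.one_mem]
      · simpa [hi] using hx i
    have habs₁ : ∀ x, ∀ i ∈ I, h₁ (Function.update x i (c i)) ∈ N := by
      intro x i hi
      by_cases hx : ∀ l, (c l)⁻¹ * Function.update x i (c i) l ∈ H
      · rw [h₁in _ hx, Function.update_comm (by rintro rfl; exact hjI hi)]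
        exact habs _ i hi
      · rw [h₁out _ hx]; exact N.one_mem
    obtain ⟨g₁, hg₁, hgN₁⟩ := ih I (J.erase j)
      (fun i hi => Finset.mem_erase.2 ⟨by rintro rfl; exact hjI hi, hIJ hi⟩)
      (by rw [Finset.erase_sdiff_comm, Finset.card_erase_of_mem hj, hd]; rfl)
      h₁ hh₁ hh₁M h₁out (by
        intro x y hx hy hxy
        rw [h₁in x hx, h₁in y hy]
        refine hdep _ _ (box_update x j hx) (box_update y j hy) fun i hi => ?_
        by_cases hij : i = j
        · subst hij; simp
        · simpa [hij] using hxy i (Finset.mem_erase.2 ⟨hij, hi⟩)) habs₁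
    obtain ⟨g₂, hg₂, hgN₂⟩ := ih (insert j I) J (Finset.insert_subset hjJ hIJ)
      (by rw [Finset.sdiff_insert, Finset.card_erase_of_mem hj, hd]; rfl)
      (fun x => (h₁ x)⁻¹ * h x) (Preserves.mul (Preserves.inv hh₁) hh)
      (fun x => M.mul_mem (M.inv_mem (hh₁M x)) (hhM x))
      (fun x hx => by simp [h₁out x hx, hout x hx]) (by
        intro x y hx hy hxy
        rw [h₁in x hx, h₁in y hy, hdep x y hx hy hxy,
          hdep _ _ (box_update x j hx) (box_update y j hy) fun i hi => ?_]
        by_cases hij : i = j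
        · subst hij; simp
        · simpa [hij] using hxy i hi) (by
        intro x i hi
        rcases Finset.mem_insert.1 hi with rfl | hi
        · by_cases hx : ∀ l, (c l)⁻¹ * Function.update x i (c i) l ∈ H
          · simp [h₁in _ hx, N.one_mem]
          · simp [h₁out _ hx, hout _ hx, N.one_mem]
        · exact N.mul_mem (N.inv_mem (habs₁ x i hi)) (habs x i hi))
    refine ⟨_, hg₁.mul hm hg₂, fun x => ?_⟩
    have e₁ := QuotientGroup.eq.2 (hgN₁ x)
    have e₂ := QuotientGroup.eq.2 (hgN₂ x)
    rw [← QuotientGroup.eq, QuotientGroup.mk_mul, e₁, e₂]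
    simp

/-- Operations with values in `M` are generated modulo `N` by operations of bounded arity. -/
theorem exists_arity_bound_mod [Finite G] (hN : N.Normal) (hHM : H ≤ M)
    (gap : ∀ K : Subgroup G, K.Normal → K ≤ H ∨ M ≤ K)
    (habs : AbsorbingInto N (fun _ => H) N) :
    ∃ m, 2 ≤ m ∧ ∀ k, 1 ≤ k → ∀ f : (Fin k → G) → G, Compatible f → (∀ x, f x ∈ M) →
      ∃ g, InClone (compatOps G m) g ∧ ∀ x, (g x)⁻¹ * f x ∈ N := by
  classical
  obtain ⟨I₀, hI₀⟩ := habs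
  refine ⟨max 2 I₀.card, le_max_left _ _, fun k hk f hf hfM => ?_⟩
  have hm : 2 ≤ max 2 I₀.card := le_max_left _ _
  have hguard := compatible_guardOp hHM gap
  have cell : ∀ q : Fin k → G ⧸ H, ∃ g, InClone (compatOps G (max 2 I₀.card)) g ∧
      ∀ x, (g x)⁻¹ * (if (fun i => (x i : G ⧸ H)) = q then f x else 1) ∈ N := by
    intro q
    have hq : ∀ x : Fin k → G,
        (fun i => (x i : G ⧸ H)) = q ↔ ∀ i, (q i).out⁻¹ * x i ∈ H := by
      intro x
      rw [funext_iff]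
      refine forall_congr' fun i => ?_
      rw [← QuotientGroup.eq, QuotientGroup.out_eq', eq_comm]
    simp only [hq]
    refine exists_inClone_of_box hN hHM gap hI₀ hm (le_max_right _ _) hk
      (fun i => (q i).out) _ ∅ Finset.univ (by simp) rfl _ ?_ ?_ ?_ ?_ (by simp)
    · refine box_restriction_closed (Q := Compatible) (H := H) (M := M) _ (fun i u hu => ?_)
        hf hfM
      refine Preserves.comp (g := ![fun x => x i, u]) (hguard _) fun l => ?_
      fin_cases l
      exacts [Preserves.proj i, hu]
    · intro x
      split_ifs
      exacts [hfM x, M.one_mem]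
    · intro x hx
      exact if_neg hx
    · intro x y _ _ hxy
      rw [funext fun i => hxy i (Finset.mem_univ i)]
  have := Fintype.ofFinite (Fin k → G ⧸ H)
  suffices ∀ T : Finset (Fin k → G ⧸ H), ∃ g, InClone (compatOps G (max 2 I₀.card)) g ∧
      ∀ x, (g x)⁻¹ * (if (fun i => (x i : G ⧸ H)) ∈ T then f x else 1) ∈ N by
    simpa using this Finset.univ
  intro T
  induction T using Finset.induction_on with
  | empty => exact ⟨fun _ => 1, .const (by omega) hk 1, by simp [N.one_mem]⟩
  | insert q T hqT ih =>
    obtain ⟨g, hg, hgN⟩ := ih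
    obtain ⟨g', hg', hgN'⟩ := cell q
    refine ⟨_, hg.mul hm hg', fun x => ?_⟩
    have e₁ := QuotientGroup.eq.2 (hgN x)
    have e₂ := QuotientGroup.eq.2 (hgN' x)
    rw [← QuotientGroup.eq, QuotientGroup.mk_mul, e₁, e₂, ← QuotientGroup.mk_mul]
    by_cases hx : (fun i => (x i : G ⧸ H)) = q
    · simp [hx, hqT]
    · simp [hx]

end Generation

end CongruencePreserving

/-- Theorem (sufficient condition, instance for finite groups): if
`⊥ = S 0 < ⋯ < S n = ⊤` enumerates the cutting elements of the lattice of
normal subgroups of a finite group `G` and each interval `I[S i, S (i+1)]`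
contains exactly the two elements `S i, S (i+1)` or does not split, then
`Comp G` is finitely generated. -/
theorem compFG_of_intervals (G : Type*) [Group G] [Finite G]
    (n : ℕ) (S : Fin (n + 1) → {H : Subgroup G // H.Normal})
    (hmono : StrictMono S) (h0 : S 0 = ⊥) (hlast : S (Fin.last n) = ⊤)
    (hcuts : ∀ i, Cuts (S i)) (hall : ∀ M : {H : Subgroup G // H.Normal}, Cuts M → ∃ i, M = S i)
    (hgood : ∀ i : Fin n,
      (∀ K : {H : Subgroup G // H.Normal}, S i.castSucc ≤ K → K ≤ S i.succ →
          K = S i.castSucc ∨ K = S i.succ)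
        ∨ ¬ IntervalSplits (S i.castSucc) (S i.succ)) :
    CompFG G := by
  have main : ∀ i : Fin (n + 1), ∃ m, 2 ≤ m ∧ ∀ k, 1 ≤ k → ∀ f : (Fin k → G) → G,
      Compatible f → ∃ g, InClone (compatOps G m) g ∧ ∀ x, (g x)⁻¹ * f x ∈ (S i).1 := by
    intro i
    induction i using Fin.reverseInduction with
    | last =>
      refine ⟨2, le_rfl, fun k hk f _ => ⟨fun _ => 1, .const (by omega) hk 1, fun x => ?_⟩⟩
      rw [hlast]
      exact Subgroup.mem_top _
    | cast i ih =>
      obtain ⟨m, hm, ih⟩ := ih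
      have hle : S i.castSucc ≤ S i.succ := hmono.monotone i.castSucc_lt_succ.le
      obtain ⟨m', -, hstep⟩ : ∃ m', 2 ≤ m' ∧ ∀ k, 1 ≤ k → ∀ f : (Fin k → G) → G,
          Compatible f → (∀ x, f x ∈ (S i.succ).1) →
          ∃ g, InClone (compatOps G m') g ∧ ∀ x, (g x)⁻¹ * f x ∈ (S i.castSucc).1 := by
        rcases hgood i with hsimple | hns
        · refine exists_arity_bound_mod (S i.castSucc).2 hle (fun K hK => ?_)
            (absorbingInto_self (S i.castSucc).2)
          rcases hcuts i.castSucc ⟨K, hK⟩ with h | h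
          · exact Or.inl h
          · rcases hcuts i.succ ⟨K, hK⟩ with h' | h'
            · rcases hsimple ⟨K, hK⟩ h h' with h'' | h''
              · exact Or.inl h''.le
              · exact Or.inr h''.ge
            · exact Or.inr h'
        · exact exists_arity_bound_mod (S i.castSucc).2 le_rfl
            (fun K hK => hcuts i.succ ⟨K, hK⟩) (absorbingInto_of_not_intervalSplits hle hns)
      refine ⟨max m m', hm.trans (le_max_left _ _), fun k hk f hf => ?_⟩
      obtain ⟨g, hg, hgf⟩ := ih k hk f hf
      obtain ⟨g', hg', hgf'⟩ := hstep k hk (fun x => (g x)⁻¹ * f x)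
        (Preserves.mul (Preserves.inv (hg.compatible fun _ h => h.2.2)) hf) hgf
      refine ⟨fun x => g x * g' x, (hg.mono (compatOps_mono (le_max_left _ _))).mul
        (hm.trans (le_max_left _ _)) (hg'.mono (compatOps_mono (le_max_right _ _))),
        fun x => ?_⟩
      simpa [mul_assoc] using hgf' x
  obtain ⟨m, -, hm⟩ := main 0
  refine ⟨compatOps G m, finite_compatOps m, fun f hf => ⟨hf.1, hf.2.2⟩, fun k hk f =>
    ⟨fun hf => ?_, fun hf => hf.compatible fun _ h => h.2.2⟩⟩
  obtain ⟨g, hg, hgf⟩ := hm k hk f hf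
  have : g = f := funext fun x => by
    have := hgf x
    rw [h0] at this
    exact inv_mul_eq_one.1 (Subgroup.mem_bot.1 this)
  exact this ▸ hg
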